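/- A triangular set T in k[x_1,…,x_n] is regular if and only if prem(P, T) = 0 for every polynomial P in the saturated ideal sat(T). -/

import Mathlib

open MvPolynomial

namespace CharSets

variable {n : ℕ} {K : Type*} [Field K]

/-- The coefficient of `x_i ^ d` in `F`, as a polynomial in the remaining variables. -/
noncomputable def coefv (i : Fin n) (d : ℕ) (F : MvPolynomial (Fin n) K) :
    MvPolynomial (Fin n) K :=
  ∑ m ∈ F.support.filter (fun m => m i = d), monomial (Finsupp.erase i m) (F.coeff m)

/-- The leading coefficient of `F` with respect to the variable `x_i`. -/
noncomputable def lcv (i : Fin n) (F : MvPolynomial (Fin n) K) : MvPolynomial (Fin n) K :=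
  coefv i (F.degreeOf i) F

/-- Auxiliary pseudo-division: computes (pseudo-quotient, pseudo-remainder) pairs,
with the first argument as fuel; the total power of the leading coefficient used is
exactly the fuel, so that starting with fuel `max(l - m + 1, 0)` yields the pair
`(Q, R)` of the unique representation `lc(F,x_i)^q • G = Q*F + R` with
`q = max(l - m + 1, 0)` and `deg(R, x_i) < deg(F, x_i)`. -/
noncomputable def pdivAux (i : Fin n) (F : MvPolynomial (Fin n) K) :
    ℕ → MvPolynomial (Fin n) K × MvPolynomial (Fin n) K →
      MvPolynomial (Fin n) K × MvPolynomial (Fin n) K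
  | 0, QR => QR
  | q + 1, QR =>
    if (QR.2).degreeOf i < F.degreeOf i then
      (lcv i F ^ (q + 1) * QR.1, lcv i F ^ (q + 1) * QR.2)
    else
      pdivAux i F q
        (lcv i F * QR.1 +
            coefv i ((QR.2).degreeOf i) QR.2 * X i ^ ((QR.2).degreeOf i - F.degreeOf i),
          lcv i F * QR.2 -
            coefv i ((QR.2).degreeOf i) QR.2 * X i ^ ((QR.2).degreeOf i - F.degreeOf i) * F)

/-- The pseudo-remainder `prem(G, F, x_i)`. -/
noncomputable def prem (G F : MvPolynomial (Fin n) K) (i : Fin n) : MvPolynomial (Fin n) K :=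
  (pdivAux i F (G.degreeOf i + 1 - F.degreeOf i) (0, G)).2

/-- The pseudo-quotient `pquo(G, F, x_i)`. -/
noncomputable def pquo (G F : MvPolynomial (Fin n) K) (i : Fin n) : MvPolynomial (Fin n) K :=
  (pdivAux i F (G.degreeOf i + 1 - F.degreeOf i) (0, G)).1

/-- The class of `P`: the largest index (1-based) of a variable actually occurring in `P`;
the class of a constant is `0`. -/
noncomputable def cls (P : MvPolynomial (Fin n) K) : ℕ :=
  P.vars.sup fun i => (i : ℕ) + 1

/-- The degree of `G` in the leading variable of `P` (`0` if `P` is constant). -/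
noncomputable def degLv (G P : MvPolynomial (Fin n) K) : ℕ :=
  if h : P.vars.Nonempty then G.degreeOf (P.vars.max' h) else 0

/-- `G` is R-reduced with respect to `P`, i.e. `deg(G, lv(P)) < deg(P, lv(P))`. -/
def RReduced (G P : MvPolynomial (Fin n) K) : Prop :=
  degLv G P < degLv P P

/-- The initial of `P`: its leading coefficient w.r.t. its leading variable. -/
noncomputable def ini (P : MvPolynomial (Fin n) K) : MvPolynomial (Fin n) K :=
  if h : P.vars.Nonempty then lcv (P.vars.max' h) P else P

/-- Pseudo-remainder of `G` w.r.t. `F` in the leading variable of `F`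
(in case `F` is constant, `m = 0` and the pseudo-remainder is `0`). -/
noncomputable def premLv (G F : MvPolynomial (Fin n) K) : MvPolynomial (Fin n) K :=
  if h : F.vars.Nonempty then prem G F (F.vars.max' h) else 0

/-- Pseudo-quotient of `G` w.r.t. `F` in the leading variable of `F`. -/
noncomputable def pquoLv (G F : MvPolynomial (Fin n) K) : MvPolynomial (Fin n) K :=
  if h : F.vars.Nonempty then pquo G F (F.vars.max' h) else 0

/-- Iterated pseudo-remainder with respect to a triangular set `[T_1, …, T_r]`:
`prem(P, T) = prem(⋯prem(P, T_r, lv(T_r)), …, T_1, lv(T_1))`. -/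
noncomputable def premTS (P : MvPolynomial (Fin n) K) (L : List (MvPolynomial (Fin n) K)) :
    MvPolynomial (Fin n) K :=
  L.foldr (fun T acc => premLv acc T) P

/-- The Sylvester matrix of `F` and `G` with respect to the variable `x_i`. -/
noncomputable def sylvester (i : Fin n) (F G : MvPolynomial (Fin n) K) :
    Matrix (Fin (G.degreeOf i + F.degreeOf i)) (Fin (G.degreeOf i + F.degreeOf i))
      (MvPolynomial (Fin n) K) :=
  Matrix.of fun r c =>
    if (r : ℕ) < G.degreeOf i then
      if (r : ℕ) ≤ (c : ℕ) ∧ (c : ℕ) ≤ (r : ℕ) + F.degreeOf i then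
        coefv i (F.degreeOf i + (r : ℕ) - (c : ℕ)) F
      else 0
    else
      if (r : ℕ) - G.degreeOf i ≤ (c : ℕ) ∧ (c : ℕ) ≤ (r : ℕ) then
        coefv i (G.degreeOf i + ((r : ℕ) - G.degreeOf i) - (c : ℕ)) G
      else 0

/-- The resultant `res(F, G, x_i)` of `F` and `G` w.r.t. `x_i`
(the determinant of the Sylvester matrix). -/
noncomputable def resv (F G : MvPolynomial (Fin n) K) (i : Fin n) : MvPolynomial (Fin n) K :=
  (sylvester i F G).det

/-- Resultant of `F` and `G` w.r.t. the leading variable of `G`. -/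
noncomputable def resLv (F G : MvPolynomial (Fin n) K) : MvPolynomial (Fin n) K :=
  if h : G.vars.Nonempty then resv F G (G.vars.max' h) else F

/-- Iterated resultant with respect to a triangular set:
`res(F, T) = res(⋯res(F, T_r, lv(T_r)), …, T_1, lv(T_1))`. -/
noncomputable def resTS (F : MvPolynomial (Fin n) K) (L : List (MvPolynomial (Fin n) K)) :
    MvPolynomial (Fin n) K :=
  L.foldr (fun T acc => resLv acc T) F

/-- A triangular set: a nonempty ordered set of nonconstant polynomials with
strictly increasing classes. -/
def TriangularSet (L : List (MvPolynomial (Fin n) K)) : Prop :=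
  L ≠ [] ∧ (∀ T ∈ L, 0 < cls T) ∧ L.Chain' fun A B => cls A < cls B

/-- An ascending set: either a single nonzero constant, or a triangular set in which
every later element is R-reduced with respect to every earlier one. -/
def AscendingSet (L : List (MvPolynomial (Fin n) K)) : Prop :=
  (∃ a : K, a ≠ 0 ∧ L = [MvPolynomial.C a]) ∨
    (TriangularSet L ∧ L.Pairwise fun A B => RReduced B A)

/-- `F` has lower rank than `G`. -/
def rkLT (F G : MvPolynomial (Fin n) K) : Prop :=
  cls F < cls G ∨ (cls F = cls G ∧ 0 < cls F ∧ degLv F F < degLv G G)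

/-- `F` and `G` have the same rank: neither has lower rank than the other. -/
def rkEQ (F G : MvPolynomial (Fin n) K) : Prop :=
  ¬ rkLT F G ∧ ¬ rkLT G F

/-- `B` has lower rank than `A` (as ascending sets). -/
def ascLT (B A : List (MvPolynomial (Fin n) K)) : Prop :=
  (∃ j, j < min A.length B.length ∧
      (∀ i, i < j → rkEQ (A.getD i 0) (B.getD i 0)) ∧ rkLT (B.getD j 0) (A.getD j 0)) ∨
    (A.length < B.length ∧ ∀ i, i < A.length → rkEQ (A.getD i 0) (B.getD i 0))

/-- A Ritt characteristic set of the ideal `I`: an ascending set contained in `I`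
of minimal rank among all ascending sets contained in `I`. -/
def RittCharSet (I : Ideal (MvPolynomial (Fin n) K)) (A : List (MvPolynomial (Fin n) K)) :
    Prop :=
  AscendingSet A ∧ (∀ a ∈ A, a ∈ I) ∧
    ∀ B : List (MvPolynomial (Fin n) K), AscendingSet B → (∀ b ∈ B, b ∈ I) → ¬ ascLT B A

/-- The saturated ideal of a triangular set, as a set of polynomials. -/
def satTS (L : List (MvPolynomial (Fin n) K)) : Set (MvPolynomial (Fin n) K) :=
  {F | ∃ q : ℕ, 0 < q ∧ (L.map ini).prod ^ q * F ∈ Ideal.span {T | T ∈ L}}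

/-- A regular set: a triangular set such that `res(ini(T_j), [T_1, …, T_{j-1}]) ≠ 0`
for `j = 2, …, r`. -/
def RegularSet (L : List (MvPolynomial (Fin n) K)) : Prop :=
  TriangularSet L ∧
    ∀ j : ℕ, 0 < j → j < L.length → resTS (ini (L.getD j 0)) (L.take j) ≠ 0

/-- A normal triangular set: `deg(ini(T_j), lv(T_i)) = 0` for all `i < j`. -/
def NormalSet (L : List (MvPolynomial (Fin n) K)) : Prop :=
  TriangularSet L ∧ L.Pairwise fun A B => degLv (ini B) A = 0

/-- The purely lexicographical order on monomials determined by `x_1 < ⋯ < x_n`. -/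
def plexLT (a b : Fin n →₀ ℕ) : Prop :=
  ∃ k : Fin n, a k < b k ∧ ∀ j : Fin n, k < j → a j = b j

/-- `m` is the leading monomial of `P` w.r.t. the plex order. -/
def IsLpp (P : MvPolynomial (Fin n) K) (m : Fin n →₀ ℕ) : Prop :=
  m ∈ P.support ∧ ∀ m' ∈ P.support, m' ≠ m → plexLT m' m

/-- `G` is the reduced (Buchberger–)Gröbner basis of the ideal `I` w.r.t. the plex
term order determined by `x_1 < ⋯ < x_n`: its elements are nonzero monic members of `I`,
the leading monomial of every nonzero member of `I` is divisible by the leading monomial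
of some element of `G`, every element of `G` is B-reduced w.r.t. the others, and `G`
generates `I`. -/
def IsReducedGB (I : Ideal (MvPolynomial (Fin n) K)) (G : Finset (MvPolynomial (Fin n) K)) :
    Prop :=
  (∀ g ∈ G, g ∈ I ∧ g ≠ 0 ∧ ∀ m, IsLpp g m → g.coeff m = 1) ∧
    (∀ F ∈ I, F ≠ 0 → ∃ g ∈ G, ∃ mg mF, IsLpp g mg ∧ IsLpp F mF ∧ mg ≤ mF) ∧
    (∀ g ∈ G, ∀ g' ∈ G, g' ≠ g → ∀ m ∈ g.support, ∀ m', IsLpp g' m' → ¬ m' ≤ m) ∧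
    Ideal.span (G : Set (MvPolynomial (Fin n) K)) = I

/-- `Cs` is the W-characteristic set of `I`: the minimal triangular set contained in the
reduced plex Gröbner basis `G` of `I`, i.e. for each class realized in `G`, `Cs` contains
the element of that class whose leading monomial is minimal w.r.t. the plex order, the
elements being ordered by increasing class (equivalently, by the plex order). -/
def IsWCharSet (I : Ideal (MvPolynomial (Fin n) K)) (Cs : List (MvPolynomial (Fin n) K)) :
    Prop :=
  ∃ G : Finset (MvPolynomial (Fin n) K), IsReducedGB I G ∧
    (Cs.Chain' fun A B => cls A < cls B) ∧
    (∀ c ∈ Cs, c ∈ G) ∧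
    (∀ g ∈ G, ∃ c ∈ Cs, cls c = cls g) ∧
    ∀ c ∈ Cs, ∀ g ∈ G, cls g = cls c → g ≠ c →
      ∃ mc mg, IsLpp c mc ∧ IsLpp g mg ∧ plexLT mc mg

/-- The set of common zeros of a set `S` of polynomials over `k`, taken in `Kc ^ n`
for an extension `Kc` of `k`. -/
def zeroSet {k : Type*} [Field k] (Kc : Type*) [CommRing Kc] [Algebra k Kc]
    (S : Set (MvPolynomial (Fin n) k)) : Set (Fin n → Kc) :=
  {a | ∀ p ∈ S, MvPolynomial.aeval a p = 0}


/-- The polynomial `F` viewed as a univariate polynomial in `x_i`, whose coefficients are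
polynomials in the remaining variables. -/
noncomputable def toPoly (i : Fin n) :
    MvPolynomial (Fin n) K →ₐ[K] Polynomial (MvPolynomial (Fin n) K) :=
  aeval fun j => if j = i then Polynomial.X else Polynomial.C (X j)

lemma toPoly_X_self (i : Fin n) :
    toPoly i (X i : MvPolynomial (Fin n) K) = Polynomial.X := by
  simp [toPoly]

lemma toPoly_of_notMem_vars {i : Fin n} {F : MvPolynomial (Fin n) K} (h : i ∉ F.vars) :
    toPoly i F = Polynomial.C F := by
  refine MvPolynomial.hom_congr_vars (f₁ := (toPoly i).toRingHom) (f₂ := Polynomial.C)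
    (p₁ := F) (p₂ := F) ?_ ?_ rfl
  · ext a
    simp [toPoly, Polynomial.algebraMap_apply, MvPolynomial.algebraMap_eq]
  · intro j hj _
    have : j ≠ i := fun e => h (e ▸ hj)
    simp [toPoly, this]

lemma degreeOf_eq_zero_iff_notMem_vars {i : Fin n} {F : MvPolynomial (Fin n) K} :
    F.degreeOf i = 0 ↔ i ∉ F.vars := by
  rw [vars_def, Multiset.mem_toFinset, ← Multiset.count_eq_zero, ← degreeOf_def]

lemma toPoly_of_degreeOf_eq_zero {i : Fin n} {F : MvPolynomial (Fin n) K}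
    (h : F.degreeOf i = 0) : toPoly i F = Polynomial.C F :=
  toPoly_of_notMem_vars (degreeOf_eq_zero_iff_notMem_vars.1 h)

lemma toPoly_monomial (i : Fin n) (m : Fin n →₀ ℕ) (a : K) :
    toPoly i (monomial m a) = Polynomial.C (monomial (m.erase i) a) * Polynomial.X ^ m i := by
  have h : monomial m a = monomial (m.erase i) a * X i ^ m i := by
    rw [X_pow_eq_monomial, monomial_mul, mul_one, Finsupp.erase_add_single]
  have h0 : (monomial (m.erase i) a).degreeOf i = 0 := by
    by_cases ha : a = 0
    · simp [ha]
    · rw [degreeOf_monomial_eq _ _ ha, Finsupp.erase_same]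
  rw [h, map_mul, map_pow, toPoly_X_self, toPoly_of_degreeOf_eq_zero h0]

lemma coeff_toPoly (i : Fin n) (d : ℕ) (F : MvPolynomial (Fin n) K) :
    (toPoly i F).coeff d = coefv i d F := by
  conv_lhs => rw [F.as_sum]
  simp only [map_sum, toPoly_monomial, Polynomial.finsetSum_coeff,
    Polynomial.coeff_C_mul_X_pow, coefv, Finset.sum_filter]
  simp only [eq_comm]

lemma eval_toPoly (i : Fin n) (F : MvPolynomial (Fin n) K) :
    (toPoly i F).eval (X i) = F := by
  conv_lhs => rw [F.as_sum]
  conv_rhs => rw [F.as_sum]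
  simp only [map_sum, toPoly_monomial, Polynomial.eval_finsetSum, Polynomial.eval_mul,
    Polynomial.eval_C, Polynomial.eval_pow, Polynomial.eval_X]
  refine Finset.sum_congr rfl fun m _ => ?_
  rw [X_pow_eq_monomial, monomial_mul, mul_one, Finsupp.erase_add_single]

lemma degreeOf_coefv_le (i j : Fin n) (d : ℕ) (F : MvPolynomial (Fin n) K) :
    (coefv i d F).degreeOf j ≤ F.degreeOf j := by
  refine (degreeOf_sum_le _ _ _).trans (Finset.sup_le fun m hm => ?_)
  have hm' := (Finset.mem_filter.1 hm).1
  rw [degreeOf_monomial_eq _ _ (mem_support_iff.1 hm')]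
  refine le_trans ?_ (monomial_le_degreeOf j hm')
  by_cases h : j = i
  · simp [h]
  · rw [Finsupp.erase_ne h]

lemma degreeOf_coefv_self (i : Fin n) (d : ℕ) (F : MvPolynomial (Fin n) K) :
    (coefv i d F).degreeOf i = 0 := by
  refine Nat.le_zero.1 ((degreeOf_sum_le _ _ _).trans (Finset.sup_le fun m hm => ?_))
  have hm' := (Finset.mem_filter.1 hm).1
  rw [degreeOf_monomial_eq _ _ (mem_support_iff.1 hm'), Finsupp.erase_same]

lemma coefv_eq_zero_of_lt {i : Fin n} {d : ℕ} {F : MvPolynomial (Fin n) K}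
    (h : F.degreeOf i < d) : coefv i d F = 0 := by
  refine Finset.sum_eq_zero fun m hm => ?_
  obtain ⟨h1, h2⟩ := Finset.mem_filter.1 hm
  have := monomial_le_degreeOf i h1
  omega

lemma natDegree_toPoly (i : Fin n) (F : MvPolynomial (Fin n) K) :
    (toPoly i F).natDegree = F.degreeOf i := by
  apply le_antisymm
  · rw [Polynomial.natDegree_le_iff_coeff_eq_zero]
    intro d hd
    rw [coeff_toPoly, coefv_eq_zero_of_lt hd]
  · conv_lhs => rw [← eval_toPoly i F, Polynomial.eval_eq_sum_range]
    refine (degreeOf_sum_le _ _ _).trans (Finset.sup_le fun d hd => ?_)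
    refine (degreeOf_mul_le _ _ _).trans ?_
    rw [coeff_toPoly, degreeOf_coefv_self, degreeOf_X_self_pow]
    have := Finset.mem_range.1 hd
    omega

lemma sum_coefv_mul_X_pow (i : Fin n) (F : MvPolynomial (Fin n) K) :
    ∑ d ∈ Finset.range (F.degreeOf i + 1), coefv i d F * X i ^ d = F := by
  conv_rhs => rw [← eval_toPoly i F, Polynomial.eval_eq_sum_range, natDegree_toPoly]
  simp only [coeff_toPoly]

lemma degreeOf_lcv_self (i : Fin n) (F : MvPolynomial (Fin n) K) :
    (lcv i F).degreeOf i = 0 :=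
  degreeOf_coefv_self _ _ _

lemma lcv_ne_zero {i : Fin n} {F : MvPolynomial (Fin n) K} (h : F ≠ 0) : lcv i F ≠ 0 := by
  intro h0
  rw [lcv, ← coeff_toPoly, ← natDegree_toPoly, Polynomial.coeff_natDegree,
    Polynomial.leadingCoeff_eq_zero] at h0
  apply h
  rw [← eval_toPoly i F, h0, Polynomial.eval_zero]

lemma degreeOf_mul_of_degreeOf_eq_zero {i : Fin n} {A F : MvPolynomial (Fin n) K}
    (h : A.degreeOf i = 0) : (A * F).degreeOf i ≤ F.degreeOf i := by
  have := degreeOf_mul_le i A F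
  omega

lemma degreeOf_pow_eq_zero {i : Fin n} {A : MvPolynomial (Fin n) K}
    (h : A.degreeOf i = 0) (q : ℕ) : (A ^ q).degreeOf i = 0 := by
  have := degreeOf_pow_le i A q
  simpa [h] using this

lemma exists_pdivAux_snd (i : Fin n) (F : MvPolynomial (Fin n) K) (q : ℕ)
    (QR : MvPolynomial (Fin n) K × MvPolynomial (Fin n) K) :
    ∃ Q, lcv i F ^ q * QR.2 = Q * F + (pdivAux i F q QR).2 := by
  induction q generalizing QR with
  | zero => exact ⟨0, by simp [pdivAux]⟩
  | succ q ih =>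
    rw [pdivAux]
    split_ifs with h
    · exact ⟨0, by simp⟩
    · obtain ⟨Q, hQ⟩ := ih (lcv i F * QR.1 +
            coefv i ((QR.2).degreeOf i) QR.2 * X i ^ ((QR.2).degreeOf i - F.degreeOf i),
          lcv i F * QR.2 -
            coefv i ((QR.2).degreeOf i) QR.2 * X i ^ ((QR.2).degreeOf i - F.degreeOf i) * F)
      refine ⟨Q + lcv i F ^ q * (coefv i ((QR.2).degreeOf i) QR.2 *
        X i ^ ((QR.2).degreeOf i - F.degreeOf i)), ?_⟩
      rw [add_mul, add_right_comm, ← hQ]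
      ring

/-- One step of pseudo-division lowers the degree. -/
lemma degreeOf_pseudo_step_lt {i : Fin n} {F G : MvPolynomial (Fin n) K}
    (h : F.degreeOf i ≤ G.degreeOf i) (h0 : 0 < G.degreeOf i) :
    (lcv i F * G - coefv i (G.degreeOf i) G * X i ^ (G.degreeOf i - F.degreeOf i) * F).degreeOf i
      < G.degreeOf i := by
  set R := lcv i F * G - coefv i (G.degreeOf i) G * X i ^ (G.degreeOf i - F.degreeOf i) * F
  suffices hs : (toPoly i R).natDegree ≤ G.degreeOf i - 1 by
    rw [natDegree_toPoly] at hs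
    omega
  rw [Polynomial.natDegree_le_iff_coeff_eq_zero]
  intro d hd'
  have hd : G.degreeOf i ≤ d := by omega
  have hR : toPoly i R = Polynomial.C (lcv i F) * toPoly i G -
      Polynomial.C (coefv i (G.degreeOf i) G) *
        (toPoly i F * Polynomial.X ^ (G.degreeOf i - F.degreeOf i)) := by
    simp only [R, map_sub, map_mul, map_pow, toPoly_X_self,
      toPoly_of_degreeOf_eq_zero (degreeOf_coefv_self _ _ _), lcv]
    ring
  rw [hR, Polynomial.coeff_sub, Polynomial.coeff_C_mul, Polynomial.coeff_C_mul,
    Polynomial.coeff_mul_X_pow', if_pos (by omega), coeff_toPoly, coeff_toPoly]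
  rcases hd.eq_or_lt with rfl | hd
  · rw [Nat.sub_sub_self h, lcv]
    ring
  · rw [coefv_eq_zero_of_lt hd, coefv_eq_zero_of_lt (by omega : F.degreeOf i < _)]
    ring

lemma degreeOf_pdivAux_snd_lt {i : Fin n} {F : MvPolynomial (Fin n) K} (hF : 0 < F.degreeOf i)
    (q : ℕ) (QR : MvPolynomial (Fin n) K × MvPolynomial (Fin n) K)
    (h : QR.2.degreeOf i < F.degreeOf i + q) :
    (pdivAux i F q QR).2.degreeOf i < F.degreeOf i := by
  induction q generalizing QR with
  | zero => simpa [pdivAux] using h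
  | succ q ih =>
    rw [pdivAux]
    split_ifs with hlt
    · exact (degreeOf_mul_of_degreeOf_eq_zero
        (degreeOf_pow_eq_zero (degreeOf_lcv_self _ _) _)).trans_lt hlt
    · apply ih
      have := degreeOf_pseudo_step_lt (not_lt.1 hlt) (by omega)
      dsimp only
      omega

lemma degreeOf_pdivAux_snd_le {i j : Fin n} {F : MvPolynomial (Fin n) K} (hF : F.degreeOf j = 0)
    (hij : j ≠ i) (q : ℕ) (QR : MvPolynomial (Fin n) K × MvPolynomial (Fin n) K) :
    (pdivAux i F q QR).2.degreeOf j ≤ QR.2.degreeOf j := by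
  have hl : (lcv i F).degreeOf j = 0 := by
    have := degreeOf_coefv_le i j (F.degreeOf i) F
    rw [lcv]
    omega
  induction q generalizing QR with
  | zero => simp [pdivAux]
  | succ q ih =>
    rw [pdivAux]
    split_ifs with hlt
    · exact degreeOf_mul_of_degreeOf_eq_zero (degreeOf_pow_eq_zero hl _)
    · refine (ih _).trans ((degreeOf_sub_le _ _ _).trans (max_le ?_ ?_))
      · exact degreeOf_mul_of_degreeOf_eq_zero hl
      · have h1 := degreeOf_coefv_le i j (QR.2.degreeOf i) QR.2
        have h2 := degreeOf_mul_le j (coefv i (QR.2.degreeOf i) QR.2 *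
          X i ^ (QR.2.degreeOf i - F.degreeOf i)) F
        have h3 := degreeOf_mul_le j (coefv i (QR.2.degreeOf i) QR.2)
          (X i ^ (QR.2.degreeOf i - F.degreeOf i))
        rw [degreeOf_X_pow_of_ne _ hij] at h3
        omega

lemma exists_prem_eq (G F : MvPolynomial (Fin n) K) (i : Fin n) :
    ∃ q Q, lcv i F ^ q * G = Q * F + prem G F i :=
  ⟨_, exists_pdivAux_snd i F _ (0, G)⟩

lemma degreeOf_prem_lt {F : MvPolynomial (Fin n) K} {i : Fin n} (hF : 0 < F.degreeOf i)
    (G : MvPolynomial (Fin n) K) : (prem G F i).degreeOf i < F.degreeOf i :=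
  degreeOf_pdivAux_snd_lt hF _ _ (by dsimp only; omega)

lemma prem_eq_self {F G : MvPolynomial (Fin n) K} {i : Fin n}
    (h : G.degreeOf i < F.degreeOf i) : prem G F i = G := by
  rw [prem, Nat.sub_eq_zero_of_le h, pdivAux]

/-- `x` is a nonzerodivisor modulo the ideal `A` (or `A` is the unit ideal). -/
def RegMod {R : Type*} [CommRing R] (A : Ideal R) (x : R) : Prop :=
  ∀ y, x * y ∈ A → y ∈ A

lemma RegMod.mul {R : Type*} [CommRing R] {A : Ideal R} {x y : R} (hx : RegMod A x)
    (hy : RegMod A y) : RegMod A (x * y) :=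
  fun z hz => hy z (hx _ (by rwa [← mul_assoc]))

lemma RegMod.pow {R : Type*} [CommRing R] {A : Ideal R} {x : R} (hx : RegMod A x) (q : ℕ) :
    RegMod A (x ^ q) := by
  induction q with
  | zero => exact fun y hy => by simpa using hy
  | succ q ih => rw [pow_succ]; exact ih.mul hx

lemma exists_prime_colon {R : Type*} [CommRing R] [IsNoetherianRing R] {A : Ideal R} {r : R}
    (h : ¬ RegMod A r) : ∃ p : Ideal R, p.IsPrime ∧ r ∈ p ∧ ∃ c, ∀ z, z ∈ p ↔ z * c ∈ A := by
  simp only [RegMod, not_forall] at h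
  obtain ⟨y, hy, hyA⟩ := h
  have hr : r ∈ ⋃ p ∈ associatedPrimes R (R ⧸ A), (p : Set R) := by
    rw [biUnion_associatedPrimes_eq_zero_divisors]
    refine ⟨Ideal.Quotient.mk A y, ?_, ?_⟩
    · rwa [Ne, Ideal.Quotient.eq_zero_iff_mem]
    · rwa [Algebra.smul_def, Ideal.Quotient.algebraMap_eq, ← map_mul,
        Ideal.Quotient.eq_zero_iff_mem]
  simp only [Set.mem_iUnion, AssociatedPrimes.mem_iff, isAssociatedPrime_iff] at hr
  obtain ⟨p, ⟨hp, x, hx⟩, hrp⟩ := hr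
  obtain ⟨c, rfl⟩ := Ideal.Quotient.mk_surjective x
  refine ⟨p, hp, hrp, c, fun z => ?_⟩
  rw [← Ideal.Quotient.eq_zero_iff_mem (I := A), map_mul, ← Ideal.Quotient.algebraMap_eq,
    ← Algebra.smul_def, hx]
  simp

/-- A form of McCoy's theorem on square linear systems over a Noetherian ring. -/
lemma exists_vecMul_mem_of_not_regMod_det {R ι : Type*} [CommRing R] [IsNoetherianRing R]
    [Fintype ι] [DecidableEq ι] {A : Ideal R} {M : Matrix ι ι R} (h : ¬ RegMod A M.det) :
    ∃ y : ι → R, (∃ j, y j ∉ A) ∧ ∀ k, ∑ j, y j * M j k ∈ A := by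
  obtain ⟨p, hp, hr, c, hc⟩ := exists_prime_colon h
  have hdet : (M.map (Ideal.Quotient.mk p)).det = 0 := by
    rw [← RingHom.mapMatrix_apply, ← RingHom.map_det, Ideal.Quotient.eq_zero_iff_mem]
    exact hr
  obtain ⟨x, hx0, hx⟩ := Matrix.exists_vecMul_eq_zero_iff.2 hdet
  choose y hy using fun j => Ideal.Quotient.mk_surjective (x j)
  refine ⟨fun j => y j * c, ?_, fun k => ?_⟩
  · by_contra! hall
    apply hx0
    ext j
    rw [← hy j, Pi.zero_apply, Ideal.Quotient.eq_zero_iff_mem, hc]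
    exact hall j
  · have hk := congrFun hx k
    simp only [Matrix.vecMul, dotProduct, Matrix.map_apply, Pi.zero_apply, ← hy, ← map_mul,
      ← map_sum, Ideal.Quotient.eq_zero_iff_mem, hc] at hk
    convert hk using 1
    rw [Finset.sum_mul]
    exact Finset.sum_congr rfl fun j _ => by ring

lemma coefv_zero (i : Fin n) (d : ℕ) : coefv i d (0 : MvPolynomial (Fin n) K) = 0 := by
  rw [← coeff_toPoly, map_zero, Polynomial.coeff_zero]

lemma coefv_sum {ι : Type*} (s : Finset ι) (i : Fin n) (d : ℕ)
    (f : ι → MvPolynomial (Fin n) K) :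
    coefv i d (∑ k ∈ s, f k) = ∑ k ∈ s, coefv i d (f k) := by
  simp only [← coeff_toPoly, map_sum, Polynomial.finsetSum_coeff]

lemma coefv_mul_left {i : Fin n} {A : MvPolynomial (Fin n) K} (h : A.degreeOf i = 0) (d : ℕ)
    (F : MvPolynomial (Fin n) K) : coefv i d (A * F) = A * coefv i d F := by
  simp only [← coeff_toPoly, map_mul, toPoly_of_degreeOf_eq_zero h, Polynomial.coeff_C_mul]

lemma coefv_mul_right {i : Fin n} {A : MvPolynomial (Fin n) K} (h : A.degreeOf i = 0) (d : ℕ)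
    (F : MvPolynomial (Fin n) K) : coefv i d (F * A) = coefv i d F * A := by
  rw [mul_comm, coefv_mul_left h, mul_comm]

lemma mem_of_forall_coefv_mem {A : Ideal (MvPolynomial (Fin n) K)} {i : Fin n}
    {F : MvPolynomial (Fin n) K} (h : ∀ d, coefv i d F ∈ A) : F ∈ A := by
  rw [← sum_coefv_mul_X_pow i F]
  exact A.sum_mem fun d _ => A.mul_mem_right _ (h d)

/-- The ideal `A` contains the coefficients in `x_i` of its members. -/
def CoefClosed (i : Fin n) (A : Ideal (MvPolynomial (Fin n) K)) : Prop :=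
  ∀ F ∈ A, ∀ d, coefv i d F ∈ A

lemma CoefClosed.quot_mem {i : Fin n} {A : Ideal (MvPolynomial (Fin n) K)}
    (hA : CoefClosed i A) {D Q F : MvPolynomial (Fin n) K}
    (hD : D.degreeOf i < F.degreeOf i ∨ D = 0)
    (hF : RegMod A (lcv i F)) (h : D - Q * F ∈ A) : Q ∈ A := by
  let ψ := (Polynomial.mapRingHom (Ideal.Quotient.mk A)).comp (toPoly i).toRingHom
  have hψ (G : MvPolynomial (Fin n) K) (d : ℕ) :
      (ψ G).coeff d = Ideal.Quotient.mk A (coefv i d G) := by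
    simp [ψ, coeff_toPoly]
  have hdeg (G : MvPolynomial (Fin n) K) : (ψ G).natDegree ≤ G.degreeOf i := by
    rw [Polynomial.natDegree_le_iff_coeff_eq_zero]
    intro d hd
    rw [hψ, coefv_eq_zero_of_lt hd, map_zero]
  have hDQ : ψ D = ψ Q * ψ F := by
    rw [← map_mul, ← sub_eq_zero, ← map_sub]
    ext d
    rw [hψ, Polynomial.coeff_zero, Ideal.Quotient.eq_zero_iff_mem]
    exact hA _ h d
  have hQ : ψ Q = 0 := by
    have hc := Polynomial.coeff_mul_add_eq_of_natDegree_le (le_refl (ψ Q).natDegree) (hdeg F)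
    have hD0 : coefv i ((ψ Q).natDegree + F.degreeOf i) D = 0 := by
      rcases hD with hD | rfl
      · exact coefv_eq_zero_of_lt (by omega)
      · exact coefv_zero _ _
    rw [← hDQ, hψ, hψ, hψ, hD0, ← map_mul, map_zero, eq_comm, Ideal.Quotient.eq_zero_iff_mem,
      mul_comm] at hc
    rw [← Polynomial.leadingCoeff_eq_zero, Polynomial.leadingCoeff, hψ,
      Ideal.Quotient.eq_zero_iff_mem]
    exact hF _ hc
  refine mem_of_forall_coefv_mem (i := i) fun d => ?_
  rw [← Ideal.Quotient.eq_zero_iff_mem, ← hψ, hQ, Polynomial.coeff_zero]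

lemma degreeOf_sylvester_apply (i : Fin n) (F G : MvPolynomial (Fin n) K)
    (r c : Fin (G.degreeOf i + F.degreeOf i)) : (sylvester i F G r c).degreeOf i = 0 := by
  simp only [sylvester, Matrix.of_apply]
  split_ifs <;> simp [degreeOf_coefv_self]

lemma sum_band_mul_pow {R : Type*} [CommRing R] (f : ℕ → R) (x : R) {N r l : ℕ}
    (h : r + l < N) :
    ∑ c : Fin N, (if r ≤ (c : ℕ) ∧ (c : ℕ) ≤ r + l then f (l + r - c) else 0) * x ^ (N - 1 - c) =
      x ^ (N - 1 - r - l) * ∑ d ∈ Finset.range (l + 1), f d * x ^ d := by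
  rw [Fin.sum_univ_eq_sum_range (fun c => (if r ≤ c ∧ c ≤ r + l then f (l + r - c) else 0) *
    x ^ (N - 1 - c)), Finset.mul_sum]
  simp only [ite_mul, zero_mul]
  rw [← Finset.sum_filter]
  refine Finset.sum_bij' (fun c _ => l + r - c) (fun d _ => l + r - d) ?_ ?_ ?_ ?_ ?_
  · intro c hc
    simp only [Finset.mem_filter, Finset.mem_range] at hc ⊢
    omega
  · intro d hd
    simp only [Finset.mem_filter, Finset.mem_range] at hd ⊢
    omega
  · intro c hc
    simp only [Finset.mem_filter, Finset.mem_range] at hc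
    omega
  · intro d hd
    simp only [Finset.mem_range] at hd
    omega
  · intro c hc
    simp only [Finset.mem_filter, Finset.mem_range] at hc
    rw [mul_left_comm, ← pow_add]
    congr 2
    omega

lemma sylvester_castAdd (i : Fin n) (F G : MvPolynomial (Fin n) K) (j : Fin (G.degreeOf i)) :
    ∑ c, sylvester i F G (Fin.castAdd _ j) c * X i ^ (G.degreeOf i + F.degreeOf i - 1 - c) =
      X i ^ (G.degreeOf i - 1 - j) * F := by
  have hj := j.2
  have h := sum_band_mul_pow (fun d => coefv i d F) (X i)
    (show (j : ℕ) + F.degreeOf i < G.degreeOf i + F.degreeOf i by omega)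
  rw [sum_coefv_mul_X_pow] at h
  convert h using 2
  · simp only [sylvester, Matrix.of_apply, Fin.val_castAdd, hj, if_true]
  · congr 1
    omega

lemma sylvester_natAdd (i : Fin n) (F G : MvPolynomial (Fin n) K) (j : Fin (F.degreeOf i)) :
    ∑ c, sylvester i F G (Fin.natAdd _ j) c * X i ^ (G.degreeOf i + F.degreeOf i - 1 - c) =
      X i ^ (F.degreeOf i - 1 - j) * G := by
  have hj := j.2
  have h := sum_band_mul_pow (fun d => coefv i d G) (X i)
    (show (j : ℕ) + G.degreeOf i < G.degreeOf i + F.degreeOf i by omega)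
  rw [sum_coefv_mul_X_pow] at h
  convert h using 2
  · simp only [sylvester, Matrix.of_apply, Fin.val_natAdd, Nat.add_sub_cancel_left]
    rw [if_neg (by omega), add_comm (degreeOf i G) (j : ℕ)]
  · congr 1
    omega

lemma degreeOf_resv (F G : MvPolynomial (Fin n) K) (i : Fin n) :
    (resv F G i).degreeOf i = 0 := by
  rw [resv, Matrix.det_apply]
  refine Nat.le_zero.1 ((degreeOf_sum_le _ _ _).trans (Finset.sup_le fun σ _ => ?_))
  rw [Units.smul_def, zsmul_eq_mul]
  refine (degreeOf_mul_le _ _ _).trans ?_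
  have h1 : degreeOf i (((Equiv.Perm.sign σ : ℤˣ) : ℤ) : MvPolynomial (Fin n) K) = 0 := by
    rw [← map_intCast (C : K →+* MvPolynomial (Fin n) K), degreeOf_C]
  have h2 : degreeOf i (∏ r, sylvester i F G (σ r) r) ≤ 0 := by
    refine (degreeOf_prod_le _ _ _).trans ?_
    simp [degreeOf_sylvester_apply]
  omega

lemma exists_resv_eq (F : MvPolynomial (Fin n) K) {G : MvPolynomial (Fin n) K} {i : Fin n}
    (hG : 0 < G.degreeOf i) : ∃ a b, resv F G i = a * F + b * G := by
  let w : Fin (G.degreeOf i + F.degreeOf i) → MvPolynomial (Fin n) K :=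
    fun c => X i ^ (G.degreeOf i + F.degreeOf i - 1 - c)
  have hrow (r) : ((sylvester i F G).mulVec w) r ∈ Ideal.span {F, G} := by
    refine Fin.addCases (fun j => ?_) (fun j => ?_) r
    · rw [Matrix.mulVec, dotProduct, sylvester_castAdd]
      exact Ideal.mul_mem_left _ _ (Ideal.subset_span (by simp))
    · rw [Matrix.mulVec, dotProduct, sylvester_natAdd]
      exact Ideal.mul_mem_left _ _ (Ideal.subset_span (by simp))
  have hadj : (sylvester i F G).adjugate.mulVec ((sylvester i F G).mulVec w) =
      resv F G i • w := by
    rw [Matrix.mulVec_mulVec, Matrix.adjugate_mul, Matrix.smul_mulVec, Matrix.one_mulVec, resv]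
  have hlast := congrFun hadj ⟨G.degreeOf i + F.degreeOf i - 1, by omega⟩
  simp only [w, Pi.smul_apply, Nat.sub_self, pow_zero, smul_eq_mul, mul_one] at hlast
  have hmem : resv F G i ∈ Ideal.span {F, G} := by
    rw [← hlast, Matrix.mulVec, dotProduct]
    exact Ideal.sum_mem _ fun r _ => Ideal.mul_mem_left _ _ (hrow r)
  obtain ⟨a, b, h⟩ := Ideal.mem_span_pair.1 hmem
  exact ⟨a, b, h.symm⟩

lemma toPoly_sum_mul_pow {i : Fin n} {m : ℕ} (w : Fin m → MvPolynomial (Fin n) K)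
    (hw : ∀ j, (w j).degreeOf i = 0) :
    toPoly i (∑ j, w j * X i ^ (m - 1 - (j : ℕ))) =
      ∑ j, Polynomial.C (w j) * Polynomial.X ^ (m - 1 - (j : ℕ)) := by
  simp only [map_sum, map_mul, map_pow, toPoly_X_self, toPoly_of_degreeOf_eq_zero (hw _)]

lemma coefv_sum_mul_pow {i : Fin n} {m : ℕ} (w : Fin m → MvPolynomial (Fin n) K)
    (hw : ∀ j, (w j).degreeOf i = 0) (j : Fin m) :
    coefv i (m - 1 - j) (∑ j, w j * X i ^ (m - 1 - (j : ℕ))) = w j := by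
  rw [← coeff_toPoly, toPoly_sum_mul_pow w hw, Polynomial.finsetSum_coeff]
  simp only [Polynomial.coeff_C_mul_X_pow]
  rw [Finset.sum_eq_single j]
  · simp
  · intro k _ hk
    rw [if_neg]
    intro h
    apply hk
    ext
    omega
  · simp

lemma degreeOf_sum_mul_pow_lt {i : Fin n} {m : ℕ} (hm : 0 < m)
    (w : Fin m → MvPolynomial (Fin n) K) (hw : ∀ j, (w j).degreeOf i = 0) :
    (∑ j, w j * X i ^ (m - 1 - (j : ℕ))).degreeOf i < m := by
  refine (degreeOf_sum_le _ _ _).trans_lt ((Finset.sup_lt_iff hm).2 fun j _ => ?_)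
  have := degreeOf_mul_le i (w j) (X i ^ (m - 1 - (j : ℕ)))
  rw [hw, degreeOf_X_self_pow] at this
  omega

/-- The properties of the saturated ideal `S` of a triangular set `T ++ [t]` with leading
variable `x_i` in terms of the saturated ideal `A` of `T`, in case the initial of `t` is a
nonzerodivisor modulo `A`. -/
structure IsSatExtension (i : Fin n) (t : MvPolynomial (Fin n) K)
    (A S : Ideal (MvPolynomial (Fin n) K)) : Prop where
  degreeOf_pos : 0 < t.degreeOf i
  coefClosed : CoefClosed i A
  regMod_lcv : RegMod A (lcv i t)
  le : A ≤ S
  mem : t ∈ S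
  regMod_lcv' : RegMod S (lcv i t)
  exists_mul_sub_mem : ∀ F ∈ S, ∃ u Q, u.degreeOf i = 0 ∧ RegMod A u ∧ u * F - Q * t ∈ A

namespace IsSatExtension

variable {i : Fin n} {t : MvPolynomial (Fin n) K} {A S : Ideal (MvPolynomial (Fin n) K)}

lemma mem_of_degreeOf_lt (h : IsSatExtension i t A S) {F : MvPolynomial (Fin n) K} (hF : F ∈ S)
    (hd : F.degreeOf i < t.degreeOf i) : F ∈ A := by
  obtain ⟨u, Q, hu, huA, hQ⟩ := h.exists_mul_sub_mem F hF
  have hQA := h.coefClosed.quot_mem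
    (.inl ((degreeOf_mul_of_degreeOf_eq_zero hu).trans_lt hd)) h.regMod_lcv hQ
  apply huA
  rw [← sub_add_cancel (u * F) (Q * t)]
  exact A.add_mem hQ (A.mul_mem_right _ hQA)

lemma regMod_of_regMod_resv (h : IsSatExtension i t A S) {F : MvPolynomial (Fin n) K}
    (hF : RegMod A (resv F t i)) : RegMod S F := by
  intro G hG
  obtain ⟨a, b, hab⟩ := exists_resv_eq F h.degreeOf_pos
  obtain ⟨q, Q, hQ⟩ := exists_prem_eq G t i
  have hmem : resv F t i * prem G t i ∈ S := by
    have : resv F t i * prem G t i =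
        lcv i t ^ q * a * (F * G) + (lcv i t ^ q * b * G - resv F t i * Q) * t := by
      rw [← sub_eq_iff_eq_add'.2 hQ, hab]
      ring
    rw [this]
    exact S.add_mem (S.mul_mem_left _ hG) (S.mul_mem_left _ h.mem)
  have hA := hF _ (h.mem_of_degreeOf_lt hmem
    ((degreeOf_mul_of_degreeOf_eq_zero (degreeOf_resv F t i)).trans_lt
      (degreeOf_prem_lt h.degreeOf_pos G)))
  refine (h.regMod_lcv'.pow q) _ ?_
  rw [hQ]
  exact S.add_mem (S.mul_mem_left _ h.mem) (h.le hA)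

lemma regMod_resv_of_regMod (h : IsSatExtension i t A S) {F : MvPolynomial (Fin n) K}
    (hF : RegMod S F) : RegMod A (resv F t i) := by
  by_contra hr
  obtain ⟨y, ⟨j, hj⟩, hy⟩ := exists_vecMul_mem_of_not_regMod_det hr
  obtain ⟨d, hd⟩ : ∃ d, coefv i d (y j) ∉ A := by
    by_contra! hall
    exact hj (mem_of_forall_coefv_mem hall)
  set z := fun k => coefv i d (y k) with hz_def
  have hz0 (k) : (z k).degreeOf i = 0 := degreeOf_coefv_self _ _ _
  have hz (c) : ∑ k, z k * sylvester i F t k c ∈ A := by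
    have := h.coefClosed _ (hy c) d
    simpa only [coefv_sum, coefv_mul_right (degreeOf_sylvester_apply i F t _ c)] using this
  let z₁ : Fin (t.degreeOf i) → MvPolynomial (Fin n) K := fun k => z (Fin.castAdd _ k)
  let z₂ : Fin (F.degreeOf i) → MvPolynomial (Fin n) K := fun k => z (Fin.natAdd _ k)
  set a := ∑ k, z₁ k * X i ^ (t.degreeOf i - 1 - (k : ℕ)) with ha
  set b := ∑ k, z₂ k * X i ^ (F.degreeOf i - 1 - (k : ℕ)) with hb
  have hab : a * F + b * t ∈ A := by
    have : a * F + b * t = ∑ c, (∑ k, z k * sylvester i F t k c) *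
        X i ^ (t.degreeOf i + F.degreeOf i - 1 - (c : ℕ)) := by
      simp only [Finset.sum_mul]
      rw [Finset.sum_comm]
      simp only [mul_assoc, ← Finset.mul_sum]
      rw [Fin.sum_univ_add]
      simp only [sylvester_castAdd, sylvester_natAdd, ha, hb, Finset.sum_mul, z₁, z₂, mul_assoc]
    rw [this]
    exact A.sum_mem fun c _ => A.mul_mem_right _ (hz c)
  have haS : a ∈ S := by
    apply hF
    rw [mul_comm, ← add_sub_cancel_right (a * F) (b * t)]
    exact S.sub_mem (h.le hab) (S.mul_mem_left _ h.mem)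
  have haA : a ∈ A :=
    h.mem_of_degreeOf_lt haS (degreeOf_sum_mul_pow_lt h.degreeOf_pos z₁ fun _ => hz0 _)
  have hbA : b ∈ A := by
    refine h.coefClosed.quot_mem (.inr rfl) h.regMod_lcv (D := 0) (F := t) ?_
    rw [zero_sub, ← add_sub_cancel_left (a * F) (b * t)]
    exact A.neg_mem (A.sub_mem hab (A.mul_mem_right _ haA))
  refine hd ?_
  change z j ∈ A
  refine Fin.addCases (motive := fun j => z j ∈ A) (fun k => ?_) (fun k => ?_) j
  · have := h.coefClosed _ haA (t.degreeOf i - 1 - k)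
    rwa [ha, coefv_sum_mul_pow z₁ fun _ => hz0 _] at this
  · have := h.coefClosed _ hbA (F.degreeOf i - 1 - k)
    rwa [hb, coefv_sum_mul_pow z₂ fun _ => hz0 _] at this

end IsSatExtension

/-- `x_i` is the leading variable of the nonconstant polynomial `t`. -/
structure IsLeadVar (i : Fin n) (t : MvPolynomial (Fin n) K) : Prop where
  degreeOf_pos : 0 < t.degreeOf i
  ini_eq : ini t = lcv i t
  premLv_eq : ∀ G, premLv G t = prem G t i
  resLv_eq : ∀ F, resLv F t = resv F t i
  degLv_eq : ∀ G, degLv G t = G.degreeOf i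
  degreeOf_eq_zero : ∀ A : MvPolynomial (Fin n) K, cls A < cls t → A.degreeOf i = 0

lemma exists_isLeadVar {t : MvPolynomial (Fin n) K} (ht : 0 < cls t) : ∃ i, IsLeadVar i t := by
  have h : t.vars.Nonempty := by
    by_contra hn
    rw [Finset.not_nonempty_iff_eq_empty] at hn
    simp [cls, hn] at ht
  refine ⟨t.vars.max' h, ?_, ?_, fun G => ?_, fun G => ?_, fun G => ?_, fun A hA => ?_⟩
  · rw [Nat.pos_iff_ne_zero, Ne, degreeOf_eq_zero_iff_notMem_vars, not_not]
    exact t.vars.max'_mem h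
  · rw [ini, dif_pos h]
  · rw [premLv, dif_pos h]
  · rw [resLv, dif_pos h]
  · rw [degLv, dif_pos h]
  · rw [degreeOf_eq_zero_iff_notMem_vars]
    intro hmem
    have h1 : ((t.vars.max' h : Fin n) : ℕ) + 1 ≤ cls A :=
      Finset.le_sup (f := fun i : Fin n => (i : ℕ) + 1) hmem
    have h2 : cls t ≤ ((t.vars.max' h : Fin n) : ℕ) + 1 := by
      refine Finset.sup_le fun j hj => ?_
      have := Fin.le_def.1 (t.vars.le_max' j hj)
      omega
    omega

lemma degreeOf_ini_le (j : Fin n) (A : MvPolynomial (Fin n) K) :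
    (ini A).degreeOf j ≤ A.degreeOf j := by
  rw [ini]
  split_ifs
  · exact degreeOf_coefv_le _ _ _ _
  · exact le_rfl

lemma ini_ne_zero {t : MvPolynomial (Fin n) K} (ht : 0 < cls t) : ini t ≠ 0 := by
  obtain ⟨i, hi⟩ := exists_isLeadVar ht
  rw [hi.ini_eq]
  refine lcv_ne_zero ?_
  rintro rfl
  simp [cls] at ht

lemma degreeOf_prod_ini_eq_zero {i : Fin n} {L : List (MvPolynomial (Fin n) K)}
    (h : ∀ A ∈ L, A.degreeOf i = 0) : ((L.map ini).prod).degreeOf i = 0 := by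
  induction L with
  | nil => simp
  | cons A L ih =>
    rw [List.map_cons, List.prod_cons]
    have h1 := degreeOf_mul_le i (ini A) (L.map ini).prod
    have h2 := degreeOf_ini_le i A
    have h3 := h A (by simp)
    have h4 := ih fun B hB => h B (by simp [hB])
    omega

/-- The saturated ideal of a list of polynomials with respect to the product of their initials. -/
def satIdeal (L : List (MvPolynomial (Fin n) K)) : Ideal (MvPolynomial (Fin n) K) where
  carrier := {F | ∃ q : ℕ, (L.map ini).prod ^ q * F ∈ Ideal.span {T | T ∈ L}}
  zero_mem' := ⟨0, by simp⟩
  add_mem' := by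
    rintro F G ⟨p, hp⟩ ⟨q, hq⟩
    refine ⟨p + q, ?_⟩
    have : (L.map ini).prod ^ (p + q) * (F + G) =
        (L.map ini).prod ^ q * ((L.map ini).prod ^ p * F) +
          (L.map ini).prod ^ p * ((L.map ini).prod ^ q * G) := by ring
    rw [this]
    exact Ideal.add_mem _ (Ideal.mul_mem_left _ _ hp) (Ideal.mul_mem_left _ _ hq)
  smul_mem' := by
    rintro A F ⟨q, hq⟩
    refine ⟨q, ?_⟩
    rw [smul_eq_mul, mul_left_comm]
    exact Ideal.mul_mem_left _ _ hq

lemma mem_satIdeal {L : List (MvPolynomial (Fin n) K)} {F : MvPolynomial (Fin n) K} :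
    F ∈ satIdeal L ↔ ∃ q : ℕ, (L.map ini).prod ^ q * F ∈ Ideal.span {T | T ∈ L} :=
  Iff.rfl

lemma mem_satTS {L : List (MvPolynomial (Fin n) K)} {F : MvPolynomial (Fin n) K} :
    F ∈ satTS L ↔ F ∈ satIdeal L := by
  constructor
  · rintro ⟨q, _, hq⟩
    exact ⟨q, hq⟩
  · rintro ⟨q, hq⟩
    refine ⟨q + 1, q.succ_pos, ?_⟩
    rw [pow_succ', mul_assoc]
    exact Ideal.mul_mem_left _ _ hq

lemma span_le_satIdeal (L : List (MvPolynomial (Fin n) K)) :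
    Ideal.span {T | T ∈ L} ≤ satIdeal L :=
  fun F hF => ⟨0, by simpa using hF⟩

lemma regMod_satIdeal_prod_ini (L : List (MvPolynomial (Fin n) K)) :
    RegMod (satIdeal L) (L.map ini).prod := by
  rintro F ⟨q, hq⟩
  exact ⟨q + 1, by rwa [pow_succ, mul_assoc]⟩

lemma mem_satIdeal_nil {F : MvPolynomial (Fin n) K} : F ∈ satIdeal [] ↔ F = 0 := by
  simp [mem_satIdeal]

lemma mem_satIdeal_append_of_ini_mul_mem {L : List (MvPolynomial (Fin n) K)}
    {t F : MvPolynomial (Fin n) K} (h : ini t * F ∈ satIdeal L) : F ∈ satIdeal (L ++ [t]) := by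
  obtain ⟨q, hq⟩ := h
  refine ⟨q + 1, ?_⟩
  have : ((L ++ [t]).map ini).prod ^ (q + 1) * F =
      (L.map ini).prod * ini t ^ q * ((L.map ini).prod ^ q * (ini t * F)) := by
    simp only [List.map_append, List.prod_append, List.map_cons, List.map_nil, List.prod_singleton]
    ring
  rw [this]
  exact Ideal.mul_mem_left _ _ (Ideal.span_mono (fun T hT => List.mem_append_left _ hT) hq)

lemma satIdeal_le_append (L : List (MvPolynomial (Fin n) K)) (t : MvPolynomial (Fin n) K) :
    satIdeal L ≤ satIdeal (L ++ [t]) :=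
  fun _ hF => mem_satIdeal_append_of_ini_mul_mem (Ideal.mul_mem_left _ _ hF)

lemma coefClosed_span {i : Fin n} {s : Set (MvPolynomial (Fin n) K)}
    (hs : ∀ A ∈ s, A.degreeOf i = 0) : CoefClosed i (Ideal.span s) := by
  intro F hF
  refine Submodule.span_induction (p := fun F _ => ∀ d, coefv i d F ∈ Ideal.span s)
    ?_ ?_ ?_ ?_ hF
  · intro A hA d
    rw [← coeff_toPoly, toPoly_of_degreeOf_eq_zero (hs A hA), Polynomial.coeff_C]
    split_ifs
    · exact Ideal.subset_span hA
    · exact Ideal.zero_mem _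
  · intro d
    rw [coefv_zero]
    exact Ideal.zero_mem _
  · intro A B _ _ hA hB d
    rw [← coeff_toPoly, map_add, Polynomial.coeff_add, coeff_toPoly, coeff_toPoly]
    exact Ideal.add_mem _ (hA d) (hB d)
  · intro A B _ hB d
    rw [smul_eq_mul, ← coeff_toPoly, map_mul, Polynomial.coeff_mul]
    refine Ideal.sum_mem _ fun x _ => Ideal.mul_mem_left _ _ ?_
    rw [coeff_toPoly]
    exact hB _

lemma coefClosed_satIdeal {i : Fin n} {L : List (MvPolynomial (Fin n) K)}
    (hL : ∀ A ∈ L, A.degreeOf i = 0) : CoefClosed i (satIdeal L) := by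
  rintro F ⟨q, hq⟩ d
  refine ⟨q, ?_⟩
  rw [← coefv_mul_left (degreeOf_pow_eq_zero (degreeOf_prod_ini_eq_zero hL) q)]
  exact coefClosed_span hL _ hq d

/-- A triangular set that is allowed to be empty. -/
def Triangular (L : List (MvPolynomial (Fin n) K)) : Prop :=
  (∀ T ∈ L, 0 < cls T) ∧ L.Pairwise fun A B => cls A < cls B

lemma TriangularSet.triangular {L : List (MvPolynomial (Fin n) K)} (h : TriangularSet L) :
    Triangular L := by
  refine ⟨h.2.1, ?_⟩
  have : IsTrans (MvPolynomial (Fin n) K) (fun A B => cls A < cls B) :=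
    ⟨fun _ _ _ => lt_trans⟩
  exact List.isChain_iff_pairwise.1 h.2.2

lemma triangular_append_singleton {L : List (MvPolynomial (Fin n) K)}
    {t : MvPolynomial (Fin n) K} :
    Triangular (L ++ [t]) ↔ Triangular L ∧ 0 < cls t ∧ ∀ A ∈ L, cls A < cls t := by
  simp only [Triangular, List.pairwise_append, List.mem_append, List.mem_singleton]
  constructor
  · rintro ⟨h1, h2, _, h3⟩
    exact ⟨⟨fun T hT => h1 T (.inl hT), h2⟩, h1 t (.inr rfl), fun A hA => h3 A hA t rfl⟩
  · rintro ⟨⟨h1, h2⟩, h3, h4⟩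
    refine ⟨?_, h2, List.pairwise_singleton _ _, ?_⟩
    · rintro T (hT | rfl)
      · exact h1 T hT
      · exact h3
    · rintro A hA _ rfl
      exact h4 A hA

lemma IsLeadVar.isSatExtension {i : Fin n} {t : MvPolynomial (Fin n) K}
    {L : List (MvPolynomial (Fin n) K)} (hi : IsLeadVar i t) (hL : ∀ A ∈ L, cls A < cls t)
    (hreg : RegMod (satIdeal L) (ini t)) :
    IsSatExtension i t (satIdeal L) (satIdeal (L ++ [t])) := by
  have hL0 : ∀ A ∈ L, A.degreeOf i = 0 := fun A hA => hi.degreeOf_eq_zero A (hL A hA)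
  have hprod : ((L ++ [t]).map ini).prod = (L.map ini).prod * ini t := by simp
  refine ⟨hi.degreeOf_pos, coefClosed_satIdeal hL0, hi.ini_eq ▸ hreg, satIdeal_le_append L t,
    span_le_satIdeal _ (Ideal.subset_span (by simp)), ?_, ?_⟩
  · rintro F ⟨q, hq⟩
    refine ⟨q + 1, ?_⟩
    have : ((L ++ [t]).map ini).prod ^ (q + 1) * F =
        (L.map ini).prod * (((L ++ [t]).map ini).prod ^ q * (lcv i t * F)) := by
      rw [hprod, ← hi.ini_eq]
      ring
    rw [this]
    exact Ideal.mul_mem_left _ _ hq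
  · rintro F ⟨q, hq⟩
    have hset : {T | T ∈ L ++ [t]} = insert t {T | T ∈ L} := by
      ext T
      simp [or_comm]
    rw [hset, Ideal.mem_span_insert, hprod] at hq
    obtain ⟨Q, z, hz, hQ⟩ := hq
    refine ⟨_, Q, ?_, ((regMod_satIdeal_prod_ini L).mul hreg).pow q, ?_⟩
    · apply degreeOf_pow_eq_zero
      have h1 := degreeOf_mul_le i (L.map ini).prod (ini t)
      have h2 := degreeOf_prod_ini_eq_zero hL0
      have h3 : (ini t).degreeOf i = 0 := by rw [hi.ini_eq, degreeOf_lcv_self]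
      omega
    · rw [hQ, add_sub_cancel_left]
      exact span_le_satIdeal L hz

/-- The condition on iterated resultants in the definition of a regular set. -/
def ResRegular (L : List (MvPolynomial (Fin n) K)) : Prop :=
  ∀ j < L.length, resTS (ini (L.getD j 0)) (L.take j) ≠ 0

lemma resRegular_append_singleton {L : List (MvPolynomial (Fin n) K)}
    {t : MvPolynomial (Fin n) K} :
    ResRegular (L ++ [t]) ↔ ResRegular L ∧ resTS (ini t) L ≠ 0 := by
  simp only [ResRegular, List.length_append, List.length_singleton, Nat.lt_succ_iff_lt_or_eq,
    or_imp, forall_and, forall_eq]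
  refine and_congr (forall₂_congr fun j hj => ?_) ?_
  · rw [List.getD_append _ _ _ _ hj, List.take_append_of_le_length hj.le]
  · simp

lemma regularSet_iff_resRegular {L : List (MvPolynomial (Fin n) K)} (h : TriangularSet L) :
    RegularSet L ↔ ResRegular L := by
  refine ⟨fun hL j hj => ?_, fun hL => ⟨h, fun j _ hj => hL j hj⟩⟩
  rcases j.eq_zero_or_pos with rfl | h0
  · rw [List.getD_eq_getElem _ _ hj]
    exact ini_ne_zero (h.2.1 _ (List.getElem_mem hj))
  · exact hL.2 j h0 hj

lemma resTS_append_singleton (F t : MvPolynomial (Fin n) K)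
    (L : List (MvPolynomial (Fin n) K)) : resTS F (L ++ [t]) = resTS (resLv F t) L := by
  simp [resTS]

lemma premTS_append_singleton (F t : MvPolynomial (Fin n) K)
    (L : List (MvPolynomial (Fin n) K)) : premTS F (L ++ [t]) = premTS (premLv F t) L := by
  simp [premTS]

/-- Modulo the saturated ideal of a regular set, a polynomial is a nonzerodivisor if and only
if its iterated resultant does not vanish. -/
lemma resTS_ne_zero_iff {L : List (MvPolynomial (Fin n) K)} (hT : Triangular L)
    (hL : ResRegular L) (F : MvPolynomial (Fin n) K) :
    resTS F L ≠ 0 ↔ RegMod (satIdeal L) F := by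
  induction L using List.reverseRecOn generalizing F with
  | nil =>
    simp only [RegMod, mem_satIdeal_nil, mul_eq_zero]
    refine ⟨fun h y hy => hy.resolve_left h, fun h h0 => ?_⟩
    exact one_ne_zero (h 1 (.inl h0))
  | append_singleton L t ih =>
    obtain ⟨hT, ht, hlt⟩ := triangular_append_singleton.1 hT
    obtain ⟨hL, hres⟩ := resRegular_append_singleton.1 hL
    obtain ⟨i, hi⟩ := exists_isLeadVar ht
    have hE := hi.isSatExtension hlt ((ih hT hL _).1 hres)
    rw [resTS_append_singleton, ih hT hL, hi.resLv_eq]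
    exact ⟨hE.regMod_of_regMod_resv, hE.regMod_resv_of_regMod⟩

lemma exists_premTS_sub_mem {L : List (MvPolynomial (Fin n) K)} (hT : Triangular L)
    (P : MvPolynomial (Fin n) K) :
    ∃ h s, h ∣ (L.map ini).prod ^ s ∧ h * P - premTS P L ∈ Ideal.span {T | T ∈ L} := by
  induction L using List.reverseRecOn generalizing P with
  | nil => exact ⟨1, 0, by simp, by simp [premTS]⟩
  | append_singleton L t ih =>
    obtain ⟨hT, ht, -⟩ := triangular_append_singleton.1 hT
    obtain ⟨i, hi⟩ := exists_isLeadVar ht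
    obtain ⟨h, s, hs, hmem⟩ := ih hT (premLv P t)
    obtain ⟨q, Q, hQ⟩ := exists_prem_eq P t i
    refine ⟨h * ini t ^ q, s + q, ?_, ?_⟩
    · simp only [List.map_append, List.prod_append, List.map_cons, List.map_nil,
        List.prod_singleton, mul_pow]
      exact mul_dvd_mul (hs.trans (pow_dvd_pow _ (Nat.le_add_right _ _)))
        (pow_dvd_pow _ (Nat.le_add_left _ _))
    · have : h * ini t ^ q * P - premTS P (L ++ [t]) =
          h * Q * t + (h * premLv P t - premTS (premLv P t) L) := by
        rw [premTS_append_singleton, hi.ini_eq, mul_assoc, hQ, hi.premLv_eq]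
        ring
      rw [this]
      exact Ideal.add_mem _ (Ideal.mul_mem_left _ _ (Ideal.subset_span (by simp)))
        (Ideal.span_mono (fun T hT => List.mem_append_left _ hT) hmem)

lemma degreeOf_premTS_le {i : Fin n} {L : List (MvPolynomial (Fin n) K)}
    (hL : ∀ A ∈ L, 0 < cls A) (h0 : ∀ A ∈ L, A.degreeOf i = 0) (P : MvPolynomial (Fin n) K) :
    (premTS P L).degreeOf i ≤ P.degreeOf i := by
  induction L with
  | nil => simp [premTS]
  | cons A L ih =>
    have hc : premTS P (A :: L) = premLv (premTS P L) A := rfl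
    obtain ⟨j, hj⟩ := exists_isLeadVar (hL A (by simp))
    have hA := h0 A (by simp)
    have hij : i ≠ j := by
      rintro rfl
      have := hj.degreeOf_pos
      omega
    rw [hc, hj.premLv_eq]
    exact (degreeOf_pdivAux_snd_le hA hij _ _).trans
      (ih (fun B hB => hL B (by simp [hB])) fun B hB => h0 B (by simp [hB]))

lemma rReduced_premTS {L : List (MvPolynomial (Fin n) K)} (hT : Triangular L)
    (P : MvPolynomial (Fin n) K) : ∀ T ∈ L, RReduced (premTS P L) T := by
  induction L using List.reverseRecOn generalizing P with
  | nil => simp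
  | append_singleton L t ih =>
    obtain ⟨hL, ht, hlt⟩ := triangular_append_singleton.1 hT
    rw [premTS_append_singleton]
    intro T hTmem
    rcases List.mem_append.1 hTmem with hTL | hTt
    · exact ih hL _ T hTL
    · rw [List.mem_singleton.1 hTt]
      obtain ⟨i, hi⟩ := exists_isLeadVar ht
      rw [RReduced, hi.degLv_eq, hi.degLv_eq]
      refine (degreeOf_premTS_le hL.1
        (fun A hA => hi.degreeOf_eq_zero A (hlt A hA)) _).trans_lt ?_
      rw [hi.premLv_eq]
      exact degreeOf_prem_lt hi.degreeOf_pos P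

lemma premTS_eq_self {L : List (MvPolynomial (Fin n) K)} (hL : ∀ T ∈ L, 0 < cls T)
    {P : MvPolynomial (Fin n) K} (hP : ∀ T ∈ L, RReduced P T) : premTS P L = P := by
  induction L with
  | nil => rfl
  | cons A L ih =>
    have hc : premTS P (A :: L) = premLv (premTS P L) A := rfl
    rw [hc, ih (fun B hB => hL B (by simp [hB])) fun B hB => hP B (by simp [hB])]
    obtain ⟨i, hi⟩ := exists_isLeadVar (hL A (by simp))
    have hA := hP A (by simp)
    rw [RReduced, hi.degLv_eq, hi.degLv_eq] at hA
    rw [hi.premLv_eq, prem_eq_self hA]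

lemma RReduced.coefv {P T : MvPolynomial (Fin n) K} (hT : 0 < cls T) (h : RReduced P T)
    (i : Fin n) (d : ℕ) : RReduced (coefv i d P) T := by
  obtain ⟨j, hj⟩ := exists_isLeadVar hT
  rw [RReduced, hj.degLv_eq, hj.degLv_eq] at h ⊢
  exact (degreeOf_coefv_le _ _ _ _).trans_lt h

/-- A triangular set is regular if and only if its saturated ideal contains no nonzero
reduced polynomial. -/
lemma resRegular_iff_forall_rReduced {L : List (MvPolynomial (Fin n) K)} (hT : Triangular L) :
    ResRegular L ↔ ∀ P ∈ satIdeal L, (∀ T ∈ L, RReduced P T) → P = 0 := by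
  induction L using List.reverseRecOn with
  | nil =>
    refine ⟨fun _ P hP _ => mem_satIdeal_nil.1 hP, fun _ j hj => ?_⟩
    simp at hj
  | append_singleton L t ih =>
    obtain ⟨hT, ht, hlt⟩ := triangular_append_singleton.1 hT
    obtain ⟨i, hi⟩ := exists_isLeadVar ht
    rw [resRegular_append_singleton]
    constructor
    · rintro ⟨hL, hres⟩ P hP hred
      have hE := hi.isSatExtension hlt ((resTS_ne_zero_iff hT hL _).1 hres)
      have hdeg := hred t (by simp)
      rw [RReduced, hi.degLv_eq, hi.degLv_eq] at hdeg
      exact (ih hT).1 hL P (hE.mem_of_degreeOf_lt hP hdeg) fun T hTL => hred T (by simp [hTL])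
    · intro h
      have hcc : CoefClosed i (satIdeal L) :=
        coefClosed_satIdeal fun A hA => hi.degreeOf_eq_zero A (hlt A hA)
      have hzero (P : MvPolynomial (Fin n) K) (hred : ∀ T ∈ L, RReduced P T)
          (hP : ∀ d, coefv i d P ∈ satIdeal (L ++ [t])) : P = 0 := by
        rw [← sum_coefv_mul_X_pow i P]
        refine Finset.sum_eq_zero fun d _ => ?_
        rw [h _ (hP d), zero_mul]
        intro T hTmem
        rcases List.mem_append.1 hTmem with hTL | hTt
        · exact (hred T hTL).coefv (hT.1 T hTL) i d
        · obtain rfl := List.mem_singleton.1 hTt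
          rw [RReduced, hi.degLv_eq, hi.degLv_eq, degreeOf_coefv_self]
          exact hi.degreeOf_pos
      have hL : ResRegular L := (ih hT).2 fun P hP hred =>
        hzero P hred fun d => satIdeal_le_append L t (hcc P hP d)
      refine ⟨hL, (resTS_ne_zero_iff hT hL _).2 fun P hP => ?_⟩
      obtain ⟨u, s, hu, hmem⟩ := exists_premTS_sub_mem hT P
      have hini : (ini t).degreeOf i = 0 := by rw [hi.ini_eq, degreeOf_lcv_self]
      have hprem : ini t * premTS P L ∈ satIdeal L := by
        have : ini t * premTS P L = u * (ini t * P) - ini t * (u * P - premTS P L) := by ring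
        rw [this]
        exact Ideal.sub_mem _ (Ideal.mul_mem_left _ _ hP)
          (Ideal.mul_mem_left _ _ (span_le_satIdeal L hmem))
      have h0 : premTS P L = 0 := by
        refine hzero _ (rReduced_premTS hT P) fun d => mem_satIdeal_append_of_ini_mul_mem ?_
        rw [← coefv_mul_left hini]
        exact hcc _ hprem d
      rw [h0, sub_zero] at hmem
      obtain ⟨c, hc⟩ := hu
      refine ⟨s, ?_⟩
      rw [hc, mul_right_comm, mul_comm]
      exact Ideal.mul_mem_left _ _ hmem

/-- A triangular set `T` is regular iff `prem(P, T) = 0` for every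
polynomial `P` in the saturated ideal `sat(T)`. -/
theorem statement2 {n : ℕ} {K : Type*} [Field K] (L : List (MvPolynomial (Fin n) K))
    (hT : TriangularSet L) :
    RegularSet L ↔ ∀ P ∈ satTS L, premTS P L = 0 := by
  rw [regularSet_iff_resRegular hT, resRegular_iff_forall_rReduced hT.triangular]
  simp only [mem_satTS]
  refine ⟨fun h P hP => ?_, fun h P hP hred => ?_⟩
  · obtain ⟨u, s, -, hmem⟩ := exists_premTS_sub_mem hT.triangular P
    refine h _ ?_ (rReduced_premTS hT.triangular P)
    rw [← sub_sub_cancel (u * P) (premTS P L)]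
    exact Ideal.sub_mem _ (Ideal.mul_mem_left _ _ hP) (span_le_satIdeal L hmem)
  · rw [← premTS_eq_self hT.2.1 hred, h P hP]

end CharSets
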